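/- For every nontrivial zero ρ of the Riemann zeta function, every real x > 0 and every positive integer l, δ_{l,ρ}(x) = M_η(1−ρ)·(l+1/2)^ρ/(ρ·x^ρ) − ∫₀^{(l+1/2)/x} (∫₁^∞ η(t·u)·u^{−ρ} du) dt, where M_η(1−ρ) = ∫₀^∞ η(t)·t^{−ρ} dt. -/

import Mathlib

open MeasureTheory Real Filter

/-- The function `η(x) = 8πx²(πx² − 3/2)e^{−πx²}`. -/
noncomputable def eta (x : ℝ) : ℝ :=
  8 * π * x ^ 2 * (π * x ^ 2 - 3 / 2) * Real.exp (-π * x ^ 2)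

/-- `g ρ = Z⁻¹ F_ρ`, given by `g ρ t = ∫₁^∞ η(u·t)·u^{ρ−1} du`. -/
noncomputable def g (ρ : ℂ) (t : ℝ) : ℂ :=
  ∫ u in Set.Ioi (1 : ℝ), (eta (u * t) : ℂ) * (u : ℂ) ^ (ρ - 1)

/-- `F_ρ x = ∫₁^∞ (Σ_{n≥1} η(n·t·x))·t^{ρ−1} dt`. -/
noncomputable def F (ρ : ℂ) (x : ℝ) : ℂ :=
  ∫ t in Set.Ioi (1 : ℝ), (∑' n : ℕ, (eta (((n : ℝ) + 1) * t * x) : ℂ)) * (t : ℂ) ^ (ρ - 1)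

/-- `δ_{l,ρ}(x) = ∫₀^∞ g ρ (x·t)·sin((2l+1)πt)/(πt) dt`. -/
noncomputable def delta (l : ℕ) (ρ : ℂ) (x : ℝ) : ℂ :=
  ∫ t in Set.Ioi (0 : ℝ),
    g ρ (x * t) * ((Real.sin ((2 * (l : ℝ) + 1) * π * t) / (π * t) : ℝ) : ℂ)

/-- The Fourier transform `𝔉f(y) = ∫_ℝ f(x)·e^{2πixy} dx`. -/
noncomputable def FT (f : ℝ → ℂ) (y : ℝ) : ℂ :=
  ∫ x : ℝ, f x * Complex.exp (((2 * π * x * y : ℝ) : ℂ) * Complex.I)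

open scoped Topology

/-- The primitive `-4πv³e^{−πv²}` of `eta` vanishing at the origin. -/
noncomputable def etaPrimitive (v : ℝ) : ℝ :=
  -4 * π * v ^ 3 * Real.exp (-π * v ^ 2)

lemma hasDerivAt_gaussian (v : ℝ) :
    HasDerivAt (fun v : ℝ => Real.exp (-π * v ^ 2)) (Real.exp (-π * v ^ 2) * (-π * (2 * v))) v := by
  simpa using ((hasDerivAt_pow 2 v).const_mul (-π)).exp

lemma hasDerivAt_etaPrimitive (v : ℝ) : HasDerivAt etaPrimitive (eta v) v := by
  have h := ((hasDerivAt_pow 3 v).const_mul (-4 * π)).mul (hasDerivAt_gaussian v)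
  refine h.congr_deriv ?_
  simp only [eta]
  push_cast
  ring

lemma continuous_eta : Continuous eta := by
  unfold eta
  fun_prop

lemma intervalIntegral_eta (X : ℝ) : ∫ t in (0 : ℝ)..X, eta t = etaPrimitive X := by
  rw [intervalIntegral.integral_eq_sub_of_hasDerivAt (fun v _ => hasDerivAt_etaPrimitive v)
    (continuous_eta.intervalIntegrable _ _)]
  simp [etaPrimitive]

lemma integrable_pow_mul_gaussian (k : ℕ) :
    Integrable (fun t : ℝ => t ^ k * Real.exp (-π * t ^ 2)) := by
  have h : (-1 : ℝ) < k := by linarith [(Nat.cast_nonneg k : (0 : ℝ) ≤ k)]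
  simpa using integrable_rpow_mul_exp_neg_mul_sq pi_pos h

lemma integrable_eta : Integrable eta := by
  refine (((integrable_pow_mul_gaussian 4).const_mul (8 * π ^ 2)).sub
    ((integrable_pow_mul_gaussian 2).const_mul (12 * π))).congr (.of_forall fun t => ?_)
  simp only [eta, Pi.sub_apply]
  ring

lemma tendsto_rpow_mul_gaussian (s : ℝ) :
    Tendsto (fun t : ℝ => t ^ s * Real.exp (-π * t ^ 2)) atTop (𝓝 0) := by
  refine (rpow_mul_exp_neg_mul_sq_isLittleO_exp_neg pi_pos s).trans_tendsto ?_
  exact tendsto_exp_atBot.comp (tendsto_id.const_mul_atTop_of_neg (by norm_num))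

lemma tendsto_pow_mul_gaussian (k : ℕ) :
    Tendsto (fun t : ℝ => t ^ k * Real.exp (-π * t ^ 2)) atTop (𝓝 0) := by
  simpa using tendsto_rpow_mul_gaussian k

lemma norm_cpow_mul_gaussian (s : ℂ) {t : ℝ} (ht : 0 < t) :
    ‖(t : ℂ) ^ s * (Real.exp (-π * t ^ 2) : ℝ)‖ = t ^ s.re * Real.exp (-π * t ^ 2) := by
  rw [norm_mul, Complex.norm_cpow_eq_rpow_re_of_pos ht, Complex.norm_real, Real.norm_eq_abs,
    abs_of_pos (Real.exp_pos _)]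

lemma integrableOn_cpow_mul_gaussian {s : ℂ} (hs : -1 < s.re) :
    IntegrableOn (fun t : ℝ => (t : ℂ) ^ s * (Real.exp (-π * t ^ 2) : ℝ)) (Set.Ioi 0) := by
  have hm : AEStronglyMeasurable (fun t : ℝ => (t : ℂ) ^ s * (Real.exp (-π * t ^ 2) : ℝ))
      (volume.restrict (Set.Ioi 0)) := by
    refine ContinuousOn.aestronglyMeasurable (fun t ht => ?_) measurableSet_Ioi
    refine ContinuousAt.continuousWithinAt ?_
    exact (Complex.continuousAt_ofReal_cpow_const t s (.inr (ne_of_gt ht))).mul (by fun_prop)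
  refine (integrable_norm_iff hm).mp ?_
  refine (integrableOn_rpow_mul_exp_neg_mul_sq pi_pos hs).congr_fun (fun t ht => ?_)
    measurableSet_Ioi
  exact (norm_cpow_mul_gaussian s ht).symm

lemma integrableOn_etaPrimitive_mul_cpow {s : ℂ} (hs : -4 < s.re) :
    IntegrableOn (fun t : ℝ => (etaPrimitive t : ℂ) * (t : ℂ) ^ s) (Set.Ioi 0) := by
  refine IntegrableOn.congr_fun ((integrableOn_cpow_mul_gaussian (s := s + 3)
    (by simp; linarith)).const_mul (-4 * π : ℂ)) (fun t (ht : 0 < t) => ?_) measurableSet_Ioi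
  have ht' : (t : ℂ) ≠ 0 := by exact_mod_cast ht.ne'
  have h3 : (t : ℂ) ^ (s + 3) = (t : ℂ) ^ s * (t : ℂ) ^ 3 := by
    rw [Complex.cpow_add _ _ ht']
    norm_cast
  simp only [etaPrimitive, h3]
  push_cast
  ring

lemma integrableOn_eta_mul_cpow {s : ℂ} (hs : -3 < s.re) :
    IntegrableOn (fun t : ℝ => (eta t : ℂ) * (t : ℂ) ^ s) (Set.Ioi 0) := by
  refine IntegrableOn.congr_fun (((integrableOn_cpow_mul_gaussian (s := s + 4)
    (by simp; linarith)).const_mul (8 * π ^ 2 : ℂ)).sub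
    ((integrableOn_cpow_mul_gaussian (s := s + 2) (by simp; linarith)).const_mul (12 * π : ℂ)))
    (fun t (ht : 0 < t) => ?_)
    measurableSet_Ioi
  have ht' : (t : ℂ) ≠ 0 := by exact_mod_cast ht.ne'
  have h4 : (t : ℂ) ^ (s + 4) = (t : ℂ) ^ s * (t : ℂ) ^ 4 := by
    rw [Complex.cpow_add _ _ ht']
    norm_cast
  have h2 : (t : ℂ) ^ (s + 2) = (t : ℂ) ^ s * (t : ℂ) ^ 2 := by
    rw [Complex.cpow_add _ _ ht']
    norm_cast
  simp only [eta, Pi.sub_apply, h4, h2]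
  push_cast
  ring

/-- Integration by parts for the Mellin transform of `eta`. -/
lemma integral_eta_mul_cpow {ρ : ℂ} (hρ0 : ρ ≠ 0) (hρ : ρ.re < 3) :
    ∫ t in Set.Ioi (0 : ℝ), (eta t : ℂ) * (t : ℂ) ^ (-ρ) =
      ρ * ∫ t in Set.Ioi (0 : ℝ), (etaPrimitive t : ℂ) * (t : ℂ) ^ (-ρ - 1) := by
  set f : ℝ → ℂ := fun t => (-4 * π : ℂ) * ((t : ℂ) ^ (3 - ρ) * (Real.exp (-π * t ^ 2) : ℝ)) with hf
  have hre : 0 < (3 - ρ).re := by simp; linarith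
  have hne : (3 - ρ) ≠ 0 := fun h => by simp [h] at hre
  have hI₁ := integrableOn_eta_mul_cpow (s := -ρ) (by simp; linarith)
  have hI₂ := integrableOn_etaPrimitive_mul_cpow (s := -ρ - 1) (by simp; linarith)
  have hf_eq : ∀ t : ℝ, 0 < t → f t = (etaPrimitive t : ℂ) * (t : ℂ) ^ (-ρ) := by
    intro t ht
    have ht' : (t : ℂ) ≠ 0 := by exact_mod_cast ht.ne'
    have h3 : (t : ℂ) ^ (3 - ρ) = (t : ℂ) ^ (-ρ) * (t : ℂ) ^ 3 := by
      rw [show 3 - ρ = -ρ + 3 by ring, Complex.cpow_add _ _ ht']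
      norm_cast
    simp only [hf, etaPrimitive, h3]
    push_cast
    ring
  have hderiv : ∀ t ∈ Set.Ioi (0 : ℝ), HasDerivAt f
      ((eta t : ℂ) * (t : ℂ) ^ (-ρ) - ρ * ((etaPrimitive t : ℂ) * (t : ℂ) ^ (-ρ - 1))) t := by
    intro t ht
    have h := (hasDerivAt_etaPrimitive t).ofReal_comp.mul
      (hasDerivAt_ofReal_cpow_const (ne_of_gt ht) (neg_ne_zero.mpr hρ0))
    refine (h.congr_deriv (by ring)).congr_of_eventuallyEq ?_
    filter_upwards [Ioi_mem_nhds ht] with y hy using hf_eq y hy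
  have hcont : ContinuousWithinAt f (Set.Ici 0) 0 := by
    refine ContinuousAt.continuousWithinAt ?_
    exact continuousAt_const.mul
      ((Complex.continuousAt_ofReal_cpow_const 0 _ (.inl hre)).mul (by fun_prop))
  have hlim : Tendsto f atTop (𝓝 0) := by
    have : Tendsto (fun t : ℝ => (t : ℂ) ^ (3 - ρ) * (Real.exp (-π * t ^ 2) : ℝ)) atTop (𝓝 0) := by
      rw [tendsto_zero_iff_norm_tendsto_zero]
      refine (tendsto_rpow_mul_gaussian (3 - ρ).re).congr' ?_
      filter_upwards [eventually_gt_atTop 0] with t ht using (norm_cpow_mul_gaussian _ ht).symm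
    simpa only [hf, mul_zero] using this.const_mul (-4 * π : ℂ)
  have key := integral_Ioi_of_hasDerivAt_of_tendsto hcont hderiv (hI₁.sub (hI₂.const_mul ρ)) hlim
  rw [integral_sub hI₁ (hI₂.const_mul ρ), integral_const_mul] at key
  have hf0 : f 0 = 0 := by simp [hf, Complex.zero_cpow hne]
  rw [hf0, sub_zero, sub_eq_zero] at key
  exact key

lemma integral_gaussian_mul_cos (w : ℝ) :
    ∫ t in Set.Ioi (0 : ℝ), Real.exp (-π * t ^ 2) * Real.cos (2 * π * w * t) =
      Real.exp (-π * w ^ 2) / 2 := by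
  have hfull : ∫ t : ℝ, Real.exp (-π * t ^ 2) * Real.cos (2 * π * w * t) =
      Real.exp (-π * w ^ 2) := by
    have h := congrArg Complex.re
      (fourierIntegral_gaussian (b := π) (by simpa using pi_pos) (2 * π * w))
    have hint : Integrable fun t : ℝ => Complex.exp (Complex.I * (2 * π * w) * t) *
        Complex.exp (-(π : ℂ) * t ^ 2) := by
      have := integrable_cexp_quadratic (b := (π : ℂ)) (by simpa using pi_pos)
        (Complex.I * (2 * π * w)) 0
      refine this.congr (.of_forall fun t => ?_)
      simp only [← Complex.exp_add]
      congr 1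
      ring
    have hre := integral_re hint
    simp only [RCLike.re_to_complex] at hre
    rw [← hre] at h
    have hπ : (π : ℂ) ≠ 0 := by exact_mod_cast pi_ne_zero
    have hright : (-(2 * (π : ℂ) * w) ^ 2 / (4 * π)) = ((-π * w ^ 2 : ℝ) : ℂ) := by
      push_cast
      field_simp
      ring
    rw [div_self hπ, Complex.one_cpow, one_mul, hright, Complex.exp_ofReal_re] at h
    rw [← h]
    refine integral_congr_ae (.of_forall fun t => ?_)
    have h1 : Complex.I * (2 * π * w) * t = ((2 * π * w * t : ℝ) : ℂ) * Complex.I := by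
      push_cast
      ring
    have h2 : -(π : ℂ) * t ^ 2 = ((-π * t ^ 2 : ℝ) : ℂ) := by
      push_cast
      ring
    simp only [h1, h2]
    rw [mul_comm (Complex.exp _), ← Complex.ofReal_exp, Complex.re_ofReal_mul,
      Complex.exp_ofReal_mul_I_re]
  have habs := integral_comp_abs
    (f := fun t : ℝ => Real.exp (-π * t ^ 2) * Real.cos (2 * π * w * t))
  have heven : ∀ t : ℝ, Real.cos (2 * π * w * |t|) = Real.cos (2 * π * w * t) := by
    intro t
    rcases abs_choice t with h | h <;> simp [h]
  simp only [sq_abs, heven] at habs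
  linarith

lemma abs_sin_mul_div_le (a : ℝ) (ha : 0 ≤ a) {t : ℝ} (ht : 0 < t) :
    |Real.sin (a * t) / (π * t)| ≤ a / π := by
  have h : |Real.sin (a * t)| ≤ a * t := by
    simpa [abs_of_nonneg (mul_nonneg ha ht.le)] using Real.abs_sin_le_abs (x := a * t)
  rw [abs_div, abs_of_pos (mul_pos pi_pos ht), div_le_div_iff₀ (mul_pos pi_pos ht) pi_pos]
  nlinarith [mul_le_mul_of_nonneg_right h pi_pos.le]

/-- Since `eta t / t` is a multiple of the third derivative of the Gaussian, three integrations by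
parts reduce its sine transform to the cosine transform of the Gaussian. -/
lemma integral_eta_mul_sin_div (w : ℝ) :
    ∫ t in Set.Ioi (0 : ℝ), eta t * (Real.sin (2 * π * w * t) / (π * t)) = etaPrimitive w := by
  have hπ := pi_ne_zero
  set c : ℝ := 2 * π * w with hc
  set φ : ℝ → ℝ := fun t => Real.exp (-π * t ^ 2) with hφ
  set f : ℝ → ℝ := fun t => -4 * (Real.sin (c * t) * (t ^ 2 * φ t))
    + (2 * π + c ^ 2) / π ^ 2 * (Real.sin (c * t) * (t ^ 0 * φ t))
    - 2 * c / π * (Real.cos (c * t) * (t ^ 1 * φ t)) with hf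
  have hIcos : IntegrableOn (fun t => φ t * Real.cos (c * t)) (Set.Ioi 0) := by
    have h : Integrable φ := integrable_exp_neg_mul_sq pi_pos
    refine (h.mul_bdd (c := 1) (by fun_prop) (.of_forall fun t => ?_)).integrableOn
    simpa using Real.abs_cos_le_one (c * t)
  have hIsin : IntegrableOn (fun t => eta t * (Real.sin (c * t) / (π * t))) (Set.Ioi 0) := by
    have h := ((integrable_pow_mul_gaussian 3).const_mul (8 * π)).sub
      ((integrable_pow_mul_gaussian 1).const_mul 12)
    have h' := h.mul_bdd (g := fun t => Real.sin (c * t)) (c := 1) (by fun_prop)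
      (.of_forall fun t => by simpa using Real.abs_sin_le_one (c * t))
    refine h'.integrableOn.congr_fun (fun t (ht : 0 < t) => ?_) measurableSet_Ioi
    have := ht.ne'
    simp only [eta, Pi.sub_apply]
    field_simp
    ring
  have hderiv : ∀ t ∈ Set.Ioi (0 : ℝ), HasDerivAt f
      (eta t * (Real.sin (c * t) / (π * t)) + c ^ 3 / π ^ 2 * (φ t * Real.cos (c * t))) t := by
    intro t ht
    have ht' : t ≠ 0 := ne_of_gt ht
    have hlin : HasDerivAt (fun t => c * t) c t := by simpa using (hasDerivAt_id t).const_mul c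
    have hg := hasDerivAt_gaussian t
    have h := (((hlin.sin.mul ((hasDerivAt_pow 2 t).mul hg)).const_mul (-4)).add
      ((hlin.sin.mul ((hasDerivAt_pow 0 t).mul hg)).const_mul ((2 * π + c ^ 2) / π ^ 2))).sub
      ((hlin.cos.mul ((hasDerivAt_pow 1 t).mul hg)).const_mul (2 * c / π))
    refine h.congr_deriv ?_
    simp only [eta, hφ, Pi.mul_apply]
    push_cast
    field_simp
    ring
  have hcont : ContinuousWithinAt f (Set.Ici 0) 0 := by
    have : Continuous f := by fun_prop
    exact this.continuousWithinAt
  have hlim : Tendsto f atTop (𝓝 0) := by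
    have hs (k : ℕ) : Tendsto (fun t => Real.sin (c * t) * (t ^ k * φ t)) atTop (𝓝 0) :=
      bdd_le_mul_tendsto_zero' 1 (.of_forall fun t => Real.abs_sin_le_one _)
        (tendsto_pow_mul_gaussian k)
    have hc' (k : ℕ) : Tendsto (fun t => Real.cos (c * t) * (t ^ k * φ t)) atTop (𝓝 0) :=
      bdd_le_mul_tendsto_zero' 1 (.of_forall fun t => Real.abs_cos_le_one _)
        (tendsto_pow_mul_gaussian k)
    simpa only [mul_zero, add_zero, sub_zero] using (((hs 2).const_mul (-4)).add
      ((hs 0).const_mul ((2 * π + c ^ 2) / π ^ 2))).sub ((hc' 1).const_mul (2 * c / π))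
  have key := integral_Ioi_of_hasDerivAt_of_tendsto hcont hderiv
    (hIsin.add (hIcos.const_mul (c ^ 3 / π ^ 2))) hlim
  rw [integral_add hIsin (hIcos.const_mul _), integral_const_mul, integral_gaussian_mul_cos] at key
  have hf0 : f 0 = 0 := by simp [hf]
  rw [hf0, sub_zero, ← eq_neg_iff_add_eq_zero] at key
  rw [key, etaPrimitive, hc]
  field_simp
  ring

lemma integral_eta_comp_mul_sin_div (w : ℝ) {a : ℝ} (ha : 0 < a) :
    ∫ t in Set.Ioi (0 : ℝ), eta (a * t) * (Real.sin (2 * π * w * t) / (π * t)) =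
      etaPrimitive (w / a) := by
  have h := integral_comp_mul_left_Ioi'
    (fun t => eta t * (Real.sin (2 * π * (w / a) * t) / (π * t))) 0 ha
  rw [mul_zero, integral_eta_mul_sin_div, smul_eq_mul, ← integral_const_mul] at h
  rw [← h]
  refine setIntegral_congr_fun measurableSet_Ioi fun t (ht : 0 < t) => ?_
  have h' : 2 * π * (w / a) * (a * t) = 2 * π * w * t := by
    field_simp
  simp only [h']
  have := ht.ne'
  field_simp

lemma integrable_prod_eta_mul_cpow {c : ℝ} (hc : 0 < c) {s : ℂ} (hs : s.re < 0) :
    Integrable (fun p : ℝ × ℝ => (eta (p.1 * c * p.2) : ℂ) * (p.1 : ℂ) ^ s)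
      ((volume.restrict (Set.Ioi 1)).prod (volume.restrict (Set.Ioi 0))) := by
  have hm : Measurable (fun p : ℝ × ℝ => (eta (p.1 * c * p.2) : ℂ) * (p.1 : ℂ) ^ s) := by
    have h := continuous_eta.measurable
    fun_prop
  refine (integrable_prod_iff hm.aestronglyMeasurable).mpr ⟨?_, ?_⟩
  · filter_upwards [ae_restrict_mem measurableSet_Ioi] with u (hu : 1 < u)
    have hu0 : u * c ≠ 0 := by positivity
    exact ((integrable_eta.comp_mul_left' hu0).ofReal.mul_const _).integrableOn
  · refine IntegrableOn.congr_fun ((integrableOn_Ioi_rpow_of_lt (a := s.re - 1) (by linarith)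
      one_pos).const_mul (c⁻¹ * ∫ t in Set.Ioi (0 : ℝ), |eta t|)) (fun u (hu : 1 < u) => ?_)
      measurableSet_Ioi
    have hu0 : 0 < u := by linarith
    have h := integral_comp_mul_left_Ioi (fun t => |eta t|) 0 (mul_pos hu0 hc)
    simp only [norm_mul, Complex.norm_real, Real.norm_eq_abs,
      Complex.norm_cpow_eq_rpow_re_of_pos hu0]
    rw [integral_mul_const, h, mul_zero, smul_eq_mul, Real.rpow_sub_one hu0.ne']
    field_simp

lemma delta_eq_integral_etaPrimitive (l : ℕ) {ρ : ℂ} (hρ : ρ.re < 1) {x : ℝ} (hx : 0 < x) :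
    delta l ρ x = ∫ u in Set.Ioi (1 : ℝ),
      (etaPrimitive (((l : ℝ) + 1 / 2) / x / u) : ℂ) * (u : ℂ) ^ (ρ - 1) := by
  set S : ℝ → ℝ := fun t => Real.sin ((2 * (l : ℝ) + 1) * π * t) / (π * t) with hS
  have hSm : Measurable S := by fun_prop
  have hint : Integrable (fun p : ℝ × ℝ =>
      ((eta (p.1 * x * p.2) : ℂ) * (p.1 : ℂ) ^ (ρ - 1)) * (S p.2 : ℂ))
      ((volume.restrict (Set.Ioi 1)).prod (volume.restrict (Set.Ioi 0))) := by
    refine (integrable_prod_eta_mul_cpow hx (by simpa using hρ)).mul_bdd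
      (c := (2 * (l : ℝ) + 1) * π / π)
      (Complex.measurable_ofReal.comp (hSm.comp measurable_snd)).aestronglyMeasurable ?_
    rw [Measure.prod_restrict]
    filter_upwards [ae_restrict_mem (measurableSet_Ioi.prod measurableSet_Ioi)] with p hp
    rw [Complex.norm_real]
    exact abs_sin_mul_div_le _ (by positivity) hp.2
  have hswap := integral_integral_swap (f := fun t u : ℝ =>
    ((eta (u * x * t) : ℂ) * (u : ℂ) ^ (ρ - 1)) * (S t : ℂ)) hint.swap
  have hdelta : delta l ρ x = ∫ t in Set.Ioi (0 : ℝ), ∫ u in Set.Ioi (1 : ℝ),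
      ((eta (u * x * t) : ℂ) * (u : ℂ) ^ (ρ - 1)) * (S t : ℂ) := by
    simp only [integral_mul_const, mul_assoc _ x]
    rfl
  rw [hdelta, hswap]
  refine setIntegral_congr_fun measurableSet_Ioi fun u (hu : 1 < u) => ?_
  have hux : 0 < u * x := mul_pos (by linarith) hx
  have h := integral_eta_comp_mul_sin_div ((l : ℝ) + 1 / 2) hux
  simp only [show ∀ t, 2 * π * ((l : ℝ) + 1 / 2) * t = (2 * l + 1) * π * t from fun t => by ring]
    at h
  rw [div_div, mul_comm x u, ← h, ← integral_complex_ofReal, ← integral_mul_const]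
  refine integral_congr_ae (.of_forall fun t => ?_)
  simp only [hS]
  push_cast
  ring

lemma intervalIntegral_eta_mul_cpow {ρ : ℂ} (hρ : 0 < ρ.re) {X : ℝ} (hX : 0 ≤ X) :
    ∫ t in (0 : ℝ)..X, ∫ u in Set.Ioi (1 : ℝ), (eta (t * u) : ℂ) * (u : ℂ) ^ (-ρ) =
      ∫ u in Set.Ioi (1 : ℝ), (etaPrimitive (X * u) : ℂ) * (u : ℂ) ^ (-ρ - 1) := by
  have hint := (integrable_prod_eta_mul_cpow one_pos (s := -ρ) (by simpa using hρ)).swap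
  have hle : (volume.restrict (Set.uIoc 0 X)).prod (volume.restrict (Set.Ioi (1 : ℝ))) ≤
      (volume.restrict (Set.Ioi (0 : ℝ))).prod (volume.restrict (Set.Ioi (1 : ℝ))) := by
    rw [Measure.prod_restrict, Measure.prod_restrict, Set.uIoc_of_le hX]
    exact Measure.restrict_mono (Set.prod_mono Set.Ioc_subset_Ioi_self subset_rfl) le_rfl
  rw [intervalIntegral_integral_swap]
  · refine setIntegral_congr_fun measurableSet_Ioi fun u (hu : 1 < u) => ?_
    have hu0 : u ≠ 0 := by positivity
    have hu' : (u : ℂ) ≠ 0 := by exact_mod_cast hu0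
    have h : ∫ t in (0 : ℝ)..X, eta (t * u) = u⁻¹ * etaPrimitive (X * u) := by
      rw [intervalIntegral.integral_comp_mul_right eta hu0, zero_mul, intervalIntegral_eta,
        smul_eq_mul]
    simp only [intervalIntegral.integral_mul_const, intervalIntegral.integral_ofReal, h]
    rw [Complex.cpow_sub _ _ hu', Complex.cpow_one]
    push_cast
    ring
  · refine (hint.mono_measure hle).congr (.of_forall fun p => ?_)
    simp [Function.uncurry, mul_comm]

lemma integral_Ioi_one_comp_inv (f : ℝ → ℂ) :
    ∫ u in Set.Ioi (1 : ℝ), ((u ^ 2)⁻¹ : ℝ) • f u⁻¹ = ∫ u in Set.Ioc (0 : ℝ) 1, f u := by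
  have himg : (fun u : ℝ => u⁻¹) '' Set.Ioi 1 = Set.Ioo 0 1 := by
    rw [Set.image_inv_eq_inv, Set.inv_Ioi₀ one_pos, inv_one]
  rw [integral_Ioc_eq_integral_Ioo, ← himg, integral_image_eq_integral_abs_deriv_smul
    measurableSet_Ioi (fun u (hu : 1 < u) => (hasDerivAt_inv (by positivity)).hasDerivWithinAt)
    inv_injective.injOn]
  simp

theorem stmt_3 (ρ : ℂ) (hζ : riemannZeta ρ = 0) (hρ0 : 0 < ρ.re) (hρ1 : ρ.re < 1)
    (x : ℝ) (hx : 0 < x) (l : ℕ) (hl : 0 < l) :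
    delta l ρ x =
      (∫ t in Set.Ioi (0 : ℝ), (eta t : ℂ) * (t : ℂ) ^ (-ρ)) * ((l : ℂ) + 1 / 2) ^ ρ
          / (ρ * (x : ℂ) ^ ρ)
        - ∫ t in (0 : ℝ)..(((l : ℝ) + 1 / 2) / x),
            ∫ u in Set.Ioi (1 : ℝ), (eta (t * u) : ℂ) * (u : ℂ) ^ (-ρ) := by
  have hρ : ρ ≠ 0 := fun h => by simp [h] at hρ0
  set X : ℝ := ((l : ℝ) + 1 / 2) / x with hXdef
  have hX : 0 < X := by positivity
  have hXC : (X : ℂ) ≠ 0 := by exact_mod_cast hX.ne'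
  have hxρ : (x : ℂ) ^ ρ ≠ 0 := by simp [Complex.cpow_eq_zero_iff, hx.ne']
  have hXρ : ((l : ℂ) + 1 / 2) ^ ρ = (X : ℂ) ^ ρ * (x : ℂ) ^ ρ := by
    rw [← Complex.mul_cpow_ofReal_nonneg hX.le hx.le, ← Complex.ofReal_mul, hXdef,
      div_mul_cancel₀ _ hx.ne']
    push_cast
    rfl
  set K : ℝ → ℂ := fun u => (etaPrimitive (X * u) : ℂ) * (u : ℂ) ^ (-ρ - 1) with hK
  have hK_eq : ∀ u ∈ Set.Ioi (0 : ℝ), (X : ℂ) ^ (ρ + 1) *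
      ((etaPrimitive (X * u) : ℂ) * ((X * u : ℝ) : ℂ) ^ (-ρ - 1)) = K u := by
    intro u hu
    rw [Complex.ofReal_mul, Complex.mul_cpow_ofReal_nonneg hX.le (le_of_lt hu),
      show -ρ - 1 = -(ρ + 1) by ring, Complex.cpow_neg (X : ℂ)]
    have : (X : ℂ) ^ (ρ + 1) ≠ 0 := by simp [Complex.cpow_eq_zero_iff, hX.ne']
    simp only [hK, show -ρ - 1 = -(ρ + 1) by ring]
    field_simp
  have hH := integrableOn_etaPrimitive_mul_cpow (s := -ρ - 1) (by simp; linarith)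
  have hKint : IntegrableOn K (Set.Ioi 0) := by
    have h := (integrableOn_Ioi_comp_mul_left_iff _ 0 hX).mpr (by simpa using hH)
    exact IntegrableOn.congr_fun (h.const_mul ((X : ℂ) ^ (ρ + 1))) hK_eq measurableSet_Ioi
  have hMellin : ∫ u in Set.Ioi (0 : ℝ), K u =
      (X : ℂ) ^ ρ * ∫ t in Set.Ioi (0 : ℝ), (etaPrimitive t : ℂ) * (t : ℂ) ^ (-ρ - 1) := by
    rw [← setIntegral_congr_fun measurableSet_Ioi hK_eq, integral_const_mul,
      integral_comp_mul_left_Ioi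
        (fun t : ℝ => (etaPrimitive t : ℂ) * (t : ℂ) ^ (-ρ - 1)) 0 hX, mul_zero,
      Complex.cpow_add _ _ hXC, Complex.cpow_one, Complex.real_smul]
    push_cast
    field_simp
  have hsplit : ∫ u in Set.Ioi (0 : ℝ), K u =
      (∫ u in Set.Ioc (0 : ℝ) 1, K u) + ∫ u in Set.Ioi (1 : ℝ), K u := by
    rw [← setIntegral_union (Set.Ioc_disjoint_Ioi le_rfl) measurableSet_Ioi
      (hKint.mono_set Set.Ioc_subset_Ioi_self)
      (hKint.mono_set (Set.Ioi_subset_Ioi zero_le_one)), Set.Ioc_union_Ioi_eq_Ioi zero_le_one]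
  have hdelta : delta l ρ x = ∫ u in Set.Ioc (0 : ℝ) 1, K u := by
    rw [delta_eq_integral_etaPrimitive l hρ1 hx, ← integral_Ioi_one_comp_inv]
    refine setIntegral_congr_fun measurableSet_Ioi fun u (hu : 1 < u) => ?_
    have hu0 : 0 < u := by linarith
    have hu' : (u : ℂ) ≠ 0 := by exact_mod_cast hu0.ne'
    have hpow : ((u⁻¹ : ℝ) : ℂ) ^ (-ρ - 1) = (u : ℂ) ^ (ρ - 1) * (u : ℂ) ^ 2 := by
      rw [Complex.ofReal_inv, Complex.inv_cpow _ _ (by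
        rw [Complex.arg_ofReal_of_nonneg hu0.le]; exact pi_pos.ne), ← Complex.cpow_neg,
        show -(-ρ - 1) = (ρ - 1) + 2 by ring, Complex.cpow_add _ _ hu']
      norm_cast
    simp only [hK, hpow, Complex.real_smul, div_eq_mul_inv X u, ← hXdef]
    push_cast
    field_simp
  rw [intervalIntegral_eta_mul_cpow hρ0 hX.le, integral_eta_mul_cpow hρ (by linarith), hdelta,
    eq_sub_iff_add_eq, ← hsplit, hMellin, hXρ]
  field_simp
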